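/- Let A be a commutative integral domain, u a unit of A, and m ≤ n positive integers. For any I, J ∈ Π_{m,n}, there exist an integer f_{I,J} ∈ ℤ and scalars k_{L,M} ∈ A such that in O_u(G_{m,n}(A)) one has [I][J] − u^{f_{I,J}} [J][I] = Σ k_{L,M} [L][M], where the sum is over pairs (L,M) of elements of Π_{m,n} with L <st I, L <st J and L ≤st M. -/

import Mathlib

/-- The defining relations of the algebra of quantum `m × n` matrices, with parameter the
unit `u`, imposed on the free algebra on the generators `X (i,j)`. -/
inductive qMatrixRel (R : Type*) [CommRing R] (u : Rˣ) (m n : ℕ) :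
    FreeAlgebra R (Fin m × Fin n) → FreeAlgebra R (Fin m × Fin n) → Prop
  | row : ∀ (i : Fin m) (j l : Fin n), j < l →
      qMatrixRel R u m n (FreeAlgebra.ι R (i, j) * FreeAlgebra.ι R (i, l))
        ((u : R) • (FreeAlgebra.ι R (i, l) * FreeAlgebra.ι R (i, j)))
  | col : ∀ (i k : Fin m) (j : Fin n), i < k →
      qMatrixRel R u m n (FreeAlgebra.ι R (i, j) * FreeAlgebra.ι R (k, j))
        ((u : R) • (FreeAlgebra.ι R (k, j) * FreeAlgebra.ι R (i, j)))
  | antidiag : ∀ (i k : Fin m) (j l : Fin n), k < i → j < l →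
      qMatrixRel R u m n (FreeAlgebra.ι R (i, j) * FreeAlgebra.ι R (k, l))
        (FreeAlgebra.ι R (k, l) * FreeAlgebra.ι R (i, j))
  | diag : ∀ (i k : Fin m) (j l : Fin n), i < k → j < l →
      qMatrixRel R u m n (FreeAlgebra.ι R (i, j) * FreeAlgebra.ι R (k, l))
        (FreeAlgebra.ι R (k, l) * FreeAlgebra.ι R (i, j) +
          ((u : R) - ((u⁻¹ : Rˣ) : R)) • (FreeAlgebra.ι R (i, l) * FreeAlgebra.ι R (k, j)))

/-- The algebra `O_u(M_{m,n}(R))` of quantum `m × n` matrices over `R`. -/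
abbrev QuantumMat (R : Type*) [CommRing R] (u : Rˣ) (m n : ℕ) :=
  RingQuot (qMatrixRel R u m n)

/-- The generator `X i j` of the algebra of quantum matrices. -/
def qX (R : Type*) [CommRing R] (u : Rˣ) {m n : ℕ} (i : Fin m) (j : Fin n) :
    QuantumMat R u m n :=
  RingQuot.mkAlgHom R (qMatrixRel R u m n) (FreeAlgebra.ι R (i, j))

/-- The number of inversions (i.e. the Coxeter length) of a permutation of `Fin t`. -/
def permLength {t : ℕ} (σ : Equiv.Perm (Fin t)) : ℕ :=
  (Finset.univ.filter fun p : Fin t × Fin t => p.1 < p.2 ∧ σ p.2 < σ p.1).card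

/-- The index set `Π_{m,n}` of maximal quantum minors consists of the `m`-element subsets
`{j₁ < ⋯ < j_m} ⊆ {1,…,n}`, encoded as order embeddings `Fin m ↪o Fin n`; it carries the
standard partial order `I ≤st J ↔ ∀ s, i_s ≤ j_s` (pointwise order). -/
instance piPartialOrder (m n : ℕ) : PartialOrder (Fin m ↪o Fin n) :=
  PartialOrder.lift (fun f => (f : Fin m → Fin n)) DFunLike.coe_injective

instance piFinite (m n : ℕ) : Finite (Fin m ↪o Fin n) :=
  Finite.of_injective (fun f => (f : Fin m → Fin n)) DFunLike.coe_injective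

/-- The maximal quantum minor `[J] = Σ_{σ ∈ S_m} (−u)^{ℓ(σ)} X_{1 j_{σ(1)}} ⋯ X_{m j_{σ(m)}}`
of the generic matrix, for a column index set `J ∈ Π_{m,n}`. -/
def qMaximalMinor (R : Type*) [CommRing R] (u : Rˣ) {m n : ℕ} (J : Fin m ↪o Fin n) :
    QuantumMat R u m n :=
  ∑ σ : Equiv.Perm (Fin m),
    ((-(u : R)) ^ permLength σ) • (List.ofFn fun i : Fin m => qX R u i (J (σ i))).prod

/-- The image of the unit `u` of `A` in the fraction field of `A`. -/
noncomputable def uFrac (A : Type*) [CommRing A] [IsDomain A] (u : Aˣ) : (FractionRing A)ˣ :=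
  Units.map (algebraMap A (FractionRing A)).toMonoidHom u

section QuantumMinors

open Finset

variable {R B ι κ : Type*} [CommRing R] [Ring B] [Algebra R B] [LinearOrder κ]

/-- A matrix with entries in an `R`-algebra which satisfies the relations of quantum matrices. -/
structure IsQuantumMatrix [LinearOrder ι] (u : Rˣ) (x : ι → κ → B) : Prop where
  row : ∀ i j l, j < l → x i j * x i l = (u : R) • (x i l * x i j)
  col : ∀ i k j, i < k → x i j * x k j = (u : R) • (x k j * x i j)
  antidiag : ∀ i k j l, k < i → j < l → x i j * x k l = x k l * x i j
  diag : ∀ i k j l, i < k → j < l →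
    x i j * x k l = x k l * x i j + ((u : R) - ((u⁻¹ : Rˣ) : R)) • (x i l * x k j)

theorem IsQuantumMatrix.transpose [LinearOrder ι] {u : Rˣ} {x : ι → κ → B}
    (h : IsQuantumMatrix u x) : IsQuantumMatrix u (fun j i => x i j) where
  row i j l hjl := h.col j l i hjl
  col i k j hik := h.row j i k hik
  antidiag i k j l hki hjl := (h.antidiag l j k i hjl hki).symm
  diag i k j l hik hjl := by
    rw [h.diag j l i k hjl hik, h.antidiag l j i k hjl hik]

/-- The number of pairs in `S × T` whose components are in decreasing order. -/
def invCount (S T : Finset κ) : ℕ := ∑ a ∈ S, ∑ b ∈ T, if b < a then 1 else 0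

theorem invCount_union_right (S : Finset κ) {T T' : Finset κ} (h : Disjoint T T') :
    invCount S (T ∪ T') = invCount S T + invCount S T' := by
  simp [invCount, sum_union h, sum_add_distrib]

theorem invCount_insert_left {S : Finset κ} {a : κ} (h : a ∉ S) (T : Finset κ) :
    invCount (insert a S) T = invCount {a} T + invCount S T := by
  simp only [invCount, sum_insert h, sum_singleton]

theorem invCount_insert_right (S : Finset κ) {T : Finset κ} {b : κ} (h : b ∉ T) :
    invCount S (insert b T) = invCount S {b} + invCount S T := by
  simp only [invCount, sum_insert h, sum_add_distrib, sum_singleton]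

theorem invCount_singleton (a b : κ) : invCount {a} {b} = if b < a then 1 else 0 := by
  simp only [invCount, sum_singleton]

theorem invCount_eq_zero {S T : Finset κ} (h : ∀ a ∈ S, ∀ b ∈ T, a ≤ b) : invCount S T = 0 :=
  sum_eq_zero fun a ha => sum_eq_zero fun b hb => if_neg (h a ha b hb).not_gt

/-- Left multiplication by `∑ j, x i j ζ j`, where the `ζ j` generate a quantum exterior algebra
whose elements `∑ S, g S ζ_S` are identified with the families `g` of their coefficients. -/
def rowOp (u : Rˣ) (x : ι → κ → B) (i : ι) (g : Finset κ → B) (S : Finset κ) : B :=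
  ∑ j ∈ S, (-(u : R)) ^ invCount {j} S • (x i j * g (S.erase j))

/-- The composite of the operators `rowOp` over a list of rows. -/
def rowAct (u : Rˣ) (x : ι → κ → B) (A : List ι) (g : Finset κ → B) : Finset κ → B :=
  A.foldr (rowOp u x) g

/-- The quantum minor with list of rows `A` and set of columns `S`. -/
def rowMinor (u : Rˣ) (x : ι → κ → B) (A : List ι) : Finset κ → B :=
  rowAct u x A (Pi.single ∅ 1)

variable (u : Rˣ) (x : ι → κ → B)

theorem rowAct_nil (g : Finset κ → B) : rowAct u x [] g = g := rfl

theorem rowAct_cons (i : ι) (A : List ι) (g : Finset κ → B) :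
    rowAct u x (i :: A) g = rowOp u x i (rowAct u x A g) := rfl

theorem rowAct_append (A C : List ι) (g : Finset κ → B) :
    rowAct u x (A ++ C) g = rowAct u x A (rowAct u x C g) := by
  simp [rowAct, List.foldr_append]

theorem rowMinor_cons (i : ι) (A : List ι) :
    rowMinor u x (i :: A) = rowOp u x i (rowMinor u x A) := rfl

theorem rowOp_smul (i : ι) (r : R) (g : Finset κ → B) :
    rowOp u x i (r • g) = r • rowOp u x i g := by
  funext S
  simp [rowOp, smul_sum, smul_comm r]

theorem rowOp_zero (i : ι) : rowOp u x i 0 = 0 := by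
  funext S
  simp [rowOp]

theorem rowMinor_eq_zero_of_length_ne (A : List ι) (S : Finset κ) (h : A.length ≠ S.card) :
    rowMinor u x A S = 0 := by
  induction A generalizing S with
  | nil =>
    have : S ≠ ∅ := by rintro rfl; simp at h
    simp [rowMinor, rowAct_nil, this]
  | cons i A ih =>
    refine sum_eq_zero fun j hj => ?_
    have := ih (S.erase j) (by
      rw [card_erase_of_mem hj]
      have := card_pos.2 ⟨j, hj⟩
      simp at h
      omega)
    change _ • (x i j * rowMinor u x A (S.erase j)) = 0
    rw [this, mul_zero, smul_zero]

theorem rowOp_rowOp (i k : ι) (g : Finset κ → B) (S : Finset κ) :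
    rowOp u x i (rowOp u x k g) S = ∑ j ∈ S, ∑ l ∈ S, if j < l then
      (-(u : R)) ^ (invCount {j} S + invCount {l} (S.erase j)) •
        ((x i j * x k l + (-(u : R)) • (x i l * x k j)) * g ((S.erase j).erase l)) else 0 := by
  set F : κ → κ → B := fun j l => (-(u : R)) ^ (invCount {j} S + invCount {l} (S.erase j)) •
    ((x i j * x k l) * g ((S.erase j).erase l)) with hF
  have hswap : ∀ j ∈ S, ∀ l ∈ S, j < l → F l j =
      (-(u : R)) ^ (invCount {j} S + invCount {l} (S.erase j)) •
        ((-(u : R)) • (x i l * x k j) * g ((S.erase j).erase l)) := by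
    intro j hj l hl hjl
    have h1 : invCount {l} S = 1 + invCount {l} (S.erase j) := by
      conv_lhs => rw [← insert_erase hj, invCount_insert_right _ (notMem_erase j S),
        invCount_singleton, if_pos hjl]
    have h2 : invCount {j} S = invCount {j} (S.erase l) := by
      conv_lhs => rw [← insert_erase hl, invCount_insert_right _ (notMem_erase l S),
        invCount_singleton, if_neg hjl.not_gt, zero_add]
    simp only [hF]
    rw [h1, ← h2, erase_right_comm, smul_mul_assoc, smul_smul, ← pow_succ]
    congr 2
    omega
  calc rowOp u x i (rowOp u x k g) S = ∑ j ∈ S, ∑ l ∈ S.erase j, F j l := by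
        simp only [rowOp, hF, mul_sum, smul_sum, pow_add, mul_smul, mul_smul_comm, mul_assoc]
    _ = ∑ j ∈ S, ∑ l ∈ S, ((if j < l then F j l else 0) + if l < j then F j l else 0) := by
        refine sum_congr rfl fun j hj => ?_
        rw [← sum_erase (a := j) S (by simp)]
        refine sum_congr rfl fun l hl => ?_
        rcases lt_trichotomy j l with h | h | h
        · simp [h, h.not_gt]
        · simp [h] at hl
        · simp [h, h.not_gt]
    _ = ∑ j ∈ S, ∑ l ∈ S, if j < l then F j l + F l j else 0 := by
        simp only [sum_add_distrib]
        rw [sum_comm (f := fun j l => if l < j then F j l else 0)]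
        simp only [← sum_add_distrib]
        refine sum_congr rfl fun j hj => sum_congr rfl fun l hl => ?_
        split_ifs <;> simp
    _ = _ := by
        refine sum_congr rfl fun j hj => sum_congr rfl fun l hl => ?_
        split_ifs with h
        · rw [hswap j hj l hl h, hF, ← smul_add, add_mul]
        · rfl

variable {u x}

theorem rowAct_eq_sum_powerset (A : List ι) (g : Finset κ → B) (S : Finset κ) :
    rowAct u x A g S = ∑ T ∈ S.powerset,
      (-(u : R)) ^ invCount T (S \ T) • (rowMinor u x A T * g (S \ T)) := by
  induction A generalizing S with
  | nil =>
    rw [sum_eq_single ∅]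
    · simp [rowMinor, rowAct_nil, invCount]
    · intro T _ hT
      simp [rowMinor, rowAct_nil, hT]
    · simp
  | cons i A ih =>
    have hL : rowAct u x (i :: A) g S = ∑ j ∈ S, ∑ T ∈ (S.erase j).powerset,
        (-(u : R)) ^ (invCount {j} S + invCount T (S.erase j \ T)) •
          (x i j * rowMinor u x A T * g (S.erase j \ T)) := by
      simp only [rowAct_cons, rowOp, ih, mul_sum, smul_sum, pow_add, mul_smul, mul_smul_comm,
        mul_assoc]
    have hR : ∑ T ∈ S.powerset,
        (-(u : R)) ^ invCount T (S \ T) • (rowMinor u x (i :: A) T * g (S \ T)) =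
        ∑ T ∈ S.powerset, ∑ j ∈ T, (-(u : R)) ^ (invCount T (S \ T) + invCount {j} T) •
          (x i j * rowMinor u x A (T.erase j) * g (S \ T)) := by
      simp only [rowMinor_cons, rowOp, sum_mul, smul_sum, pow_add, mul_smul, smul_mul_assoc]
    rw [hL, hR, sum_sigma', sum_sigma']
    refine sum_bij' (fun p _ => ⟨insert p.1 p.2, p.1⟩) (fun p _ => ⟨p.2, p.1.erase p.2⟩)
      ?_ ?_ ?_ ?_ ?_
    · rintro ⟨j, T⟩ h
      simp only [mem_sigma, mem_powerset, mem_insert_self, and_true] at h ⊢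
      exact insert_subset h.1 (h.2.trans (erase_subset _ _))
    · rintro ⟨T, j⟩ h
      simp only [mem_sigma, mem_powerset] at h ⊢
      exact ⟨h.1 h.2, erase_subset_erase _ h.1⟩
    · rintro ⟨j, T⟩ h
      simp only [mem_sigma, mem_powerset] at h
      have : j ∉ T := fun hj => by simpa using h.2 hj
      simp [this]
    · rintro ⟨T, j⟩ h
      simp only [mem_sigma] at h
      simp [insert_erase h.2]
    · rintro ⟨j, T⟩ h
      simp only [mem_sigma, mem_powerset] at h ⊢
      have hj : j ∉ T := fun hj => by simpa using h.2 hj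
      have hd : S.erase j \ T = S \ insert j T := by
        ext a; simp; tauto
      have hS : S = insert j T ∪ (S \ insert j T) :=
        (union_sdiff_of_subset (insert_subset h.1 (h.2.trans (erase_subset _ _)))).symm
      rw [hd, erase_insert hj]
      congr 2
      have h' := invCount_union_right {j} (disjoint_sdiff (s := insert j T) (t := S))
      rw [← hS] at h'
      rw [h', invCount_insert_left hj]
      omega

theorem rowOp_insert_min {s : κ} {S : Finset κ} (hs : ∀ b ∈ S, s < b) (i : ι)
    (g : Finset κ → B) : rowOp u x i g (insert s S) = x i s * g S +
      ∑ j ∈ S, (-(u : R)) ^ (1 + invCount {j} S) • (x i j * g (insert s (S.erase j))) := by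
  have hsS : s ∉ S := fun h => (hs s h).false
  rw [rowOp, sum_insert hsS, erase_insert hsS, invCount_eq_zero, pow_zero, one_smul]
  · congr 1
    refine sum_congr rfl fun j hj => ?_
    rw [invCount_insert_right _ hsS, invCount_singleton, if_pos (hs j hj),
      erase_insert_of_ne (hs j hj).ne]
  · simpa using fun b hb => (hs b hb).le

variable [LinearOrder ι]

theorem rowOp_self (hx : IsQuantumMatrix u x) (i : ι) (g : Finset κ → B) :
    rowOp u x i (rowOp u x i g) = 0 := by
  funext S
  rw [rowOp_rowOp]
  refine sum_eq_zero fun j hj => sum_eq_zero fun l hl => ?_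
  split_ifs with h
  · rw [hx.row i j l h]
    simp
  · rfl

theorem rowOp_comm (hx : IsQuantumMatrix u x) {i k : ι} (hik : i < k) (g : Finset κ → B) :
    rowOp u x k (rowOp u x i g) = (-(u : R)) • rowOp u x i (rowOp u x k g) := by
  funext S
  rw [Pi.smul_apply, rowOp_rowOp, rowOp_rowOp, smul_sum]
  refine sum_congr rfl fun j hj => ?_
  rw [smul_sum]
  refine sum_congr rfl fun l hl => ?_
  split_ifs with h
  · have key : x k j * x i l + (-(u : R)) • (x k l * x i j) =
        (-(u : R)) • (x i j * x k l + (-(u : R)) • (x i l * x k j)) := by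
      rw [hx.diag i k j l hik h, hx.antidiag k i j l hik h]
      simp only [smul_add, smul_smul, mul_sub, neg_mul, mul_neg, neg_neg, Units.mul_inv]
      simp only [neg_smul, sub_smul, one_smul]
      abel
    rw [key, smul_mul_assoc, smul_comm]
  · simp

theorem isUnit_neg_unit (u : Rˣ) : IsUnit (-(u : R)) := u.isUnit.neg

theorem rowOp_rowAct_of_mem (hx : IsQuantumMatrix u x) {i : ι} {A : List ι} (hi : i ∈ A)
    (g : Finset κ → B) : rowOp u x i (rowAct u x A g) = 0 := by
  induction A with
  | nil => simp at hi
  | cons k A ih =>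
    rw [rowAct_cons]
    rcases lt_trichotomy i k with h | h | h
    · have := rowOp_comm hx h (rowAct u x A g)
      rw [ih (by simpa [h.ne] using hi), rowOp_zero] at this
      exact (isUnit_neg_unit u).smul_eq_zero.1 this.symm
    · rw [h, rowOp_self hx]
    · rw [rowOp_comm hx h, ih (by simpa [h.ne'] using hi), rowOp_zero, smul_zero]

theorem rowAct_of_not_nodup (hx : IsQuantumMatrix u x) {A : List ι} (hA : ¬ A.Nodup)
    (g : Finset κ → B) : rowAct u x A g = 0 := by
  induction A with
  | nil => simp at hA
  | cons i A ih =>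
    rw [rowAct_cons]
    by_cases hi : i ∈ A
    · exact rowOp_rowAct_of_mem hx hi g
    · rw [ih (by simpa [hi] using hA), rowOp_zero]

theorem sort_insert_min {S : Finset κ} {a : κ} (h : ∀ b ∈ S, a < b) :
    (insert a S).sort = a :: S.sort :=
  sort_insert _ (fun b hb => (h b hb).le) fun ha => (h a ha).false

theorem rowOp_rowAct_sort (hx : IsQuantumMatrix u x) {i : ι} {S : Finset ι} (hi : i ∉ S)
    (g : Finset κ → B) : rowOp u x i (rowAct u x S.sort g) =
      (-(u : R)) ^ invCount {i} S • rowAct u x (insert i S).sort g := by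
  induction S using Finset.induction_on_min with
  | empty => simp [rowAct, invCount]
  | insert k S hk ih =>
    have hkS : k ∉ S := fun h => (hk k h).false
    have hik : i ≠ k := fun h => hi (by simp [h])
    have hiS : i ∉ S := fun h => hi (by simp [h])
    rw [sort_insert_min hk, rowAct_cons, invCount_insert_right _ hkS, invCount_singleton]
    rcases lt_or_gt_of_ne hik with h | h
    · have hall : ∀ b ∈ insert k S, i < b := by
        intro b hb
        rcases mem_insert.1 hb with rfl | hb
        · exact h
        · exact h.trans (hk b hb)
      rw [sort_insert_min hall, sort_insert_min hk, if_neg h.not_gt, invCount_eq_zero]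
      · simp [rowAct_cons]
      · simpa using fun b hb => (h.trans (hk b hb)).le
    · have hall : ∀ b ∈ insert i S, k < b := by
        intro b hb
        rcases mem_insert.1 hb with rfl | hb
        · exact h
        · exact hk b hb
      rw [rowOp_comm hx h, ih hiS, rowOp_smul, smul_smul, if_pos h, ← pow_succ',
        insert_comm, sort_insert_min hall, rowAct_cons, add_comm]

theorem rowAct_sort_append (hx : IsQuantumMatrix u x) (X Y : Finset ι) (g : Finset κ → B) :
    rowAct u x (X.sort ++ Y.sort) g =
      if Disjoint X Y then (-(u : R)) ^ invCount X Y • rowAct u x (X ∪ Y).sort g else 0 := by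
  split_ifs with hXY
  · induction X using Finset.induction_on_min with
    | empty => simp [invCount]
    | insert a X ha ih =>
      have haX : a ∉ X := fun h => (ha a h).false
      rw [disjoint_insert_left] at hXY
      rw [sort_insert_min ha, List.cons_append, rowAct_cons, ih hXY.2, rowOp_smul,
        rowOp_rowAct_sort hx (by simp [haX, hXY.1]), invCount_union_right _ hXY.2,
        invCount_eq_zero (T := X) (by simpa using fun b hb => (ha b hb).le), zero_add, smul_smul,
        ← pow_add, invCount_insert_left haX, insert_union, add_comm]
  · refine rowAct_of_not_nodup hx (fun h => hXY ?_) g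
    rw [List.nodup_append] at h
    exact disjoint_left.2 fun a ha hb => h.2.2 a (by simpa using ha) a (by simpa using hb) rfl

theorem exists_eq_insert_min {S : Finset κ} (hS : S.Nonempty) :
    ∃ s S', (∀ b ∈ S', s < b) ∧ S = insert s S' :=
  ⟨S.min' hS, S.erase (S.min' hS), fun _ hb => S.min'_lt_of_mem_erase_min' hS hb,
    (insert_erase (S.min'_mem hS)).symm⟩

theorem rowMinor_sort_transpose (hx : IsQuantumMatrix u x) (A : Finset ι) (S : Finset κ) :
    rowMinor u x A.sort S = rowMinor u (fun j i => x i j) S.sort A := by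
  induction A using Finset.strongInduction generalizing S with
  | H A ih =>
    by_cases hc : A.card = S.card
    swap
    · rw [rowMinor_eq_zero_of_length_ne _ _ _ _ (by simpa using hc),
        rowMinor_eq_zero_of_length_ne _ _ _ _ (by simpa using Ne.symm hc)]
    rcases A.eq_empty_or_nonempty with rfl | hA
    · obtain rfl : S = ∅ := by simpa [eq_comm] using hc
      simp [rowMinor, rowAct_nil]
    have hS : S.Nonempty := card_pos.1 (hc ▸ card_pos.2 hA)
    obtain ⟨i, A, hi, rfl⟩ := exists_eq_insert_min hA
    obtain ⟨s, S, hs, rfl⟩ := exists_eq_insert_min hS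
    have hiA : i ∉ A := fun h => (hi i h).false
    rw [sort_insert_min hi, sort_insert_min hs, rowMinor_cons, rowMinor_cons,
      rowOp_insert_min hs, rowOp_insert_min hi, ih A (ssubset_insert hiA)]
    congr 1
    have hL : ∀ j ∈ S, rowMinor u x A.sort (insert s (S.erase j)) = ∑ k ∈ A,
        (-(u : R)) ^ invCount {k} A • (x k s * rowMinor u x (A.erase k).sort (S.erase j)) := by
      intro j _
      rw [ih A (ssubset_insert hiA), sort_insert_min fun b hb => hs b (mem_of_mem_erase hb),
        rowMinor_cons]
      refine sum_congr rfl fun k hk => ?_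
      rw [ih (A.erase k) ((erase_ssubset hk).trans (ssubset_insert hiA))]
    have hR : ∀ k ∈ A, rowMinor u (fun j i => x i j) S.sort (insert i (A.erase k)) = ∑ j ∈ S,
        (-(u : R)) ^ invCount {j} S • (x i j * rowMinor u x (A.erase k).sort (S.erase j)) := by
      intro k hk
      rw [← ih (insert i (A.erase k)), sort_insert_min fun b hb => hi b (mem_of_mem_erase hb),
        rowMinor_cons]
      · rfl
      · refine (insert_subset_insert _ (erase_subset _ _)).ssubset_of_mem_notMem
          (mem_insert_of_mem hk) ?_
        simpa using (hi k hk).ne'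
    refine (sum_congr rfl fun j hj => congrArg
      (fun z => (-(u : R)) ^ (1 + invCount {j} S) • (x i j * z)) (hL j hj)).trans (Eq.trans ?_
      (sum_congr rfl fun k hk => congrArg
        (fun z => (-(u : R)) ^ (1 + invCount {k} A) • (x k s * z)) (hR k hk)).symm)
    simp only [mul_sum, smul_sum, mul_smul_comm, smul_smul, ← pow_add]
    rw [sum_comm]
    refine sum_congr rfl fun k hk => sum_congr rfl fun j hj => ?_
    rw [← mul_assoc, ← mul_assoc, hx.antidiag k i s j (hi k hk) (hs j hj)]
    congr 2
    omega

/-- The generalized quantum Plücker relations. -/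
theorem sum_rowMinor_mul_rowMinor_eq_zero [Fintype ι] (hx : IsQuantumMatrix u x)
    (I₀ S J₀ : Finset κ) (hS : Fintype.card ι < S.card) :
    ∑ T ∈ S.powerset, (-(u : R)) ^ invCount T (S \ T) •
      ((if Disjoint I₀ T then (-(u : R)) ^ invCount I₀ T •
          rowMinor u x (univ : Finset ι).sort (I₀ ∪ T) else 0) *
        (if Disjoint (S \ T) J₀ then (-(u : R)) ^ invCount (S \ T) J₀ •
          rowMinor u x (univ : Finset ι).sort (S \ T ∪ J₀) else 0)) = 0 := by
  have hlap : ∀ X Y : Finset κ, (if Disjoint X Y then (-(u : R)) ^ invCount X Y •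
      rowMinor u x (univ : Finset ι).sort (X ∪ Y) else 0) =
      ∑ A ∈ (univ : Finset ι).powerset, (-(u : R)) ^ invCount A (univ \ A) •
        (rowMinor u x A.sort X * rowMinor u x (univ \ A).sort Y) := by
    intro X Y
    have h := congrFun (rowAct_sort_append hx.transpose X Y (Pi.single ∅ 1)) univ
    rw [rowAct_append, rowAct_eq_sum_powerset] at h
    simp only [rowMinor_sort_transpose hx]
    refine Eq.trans ?_ h.symm
    split_ifs <;> rfl
  have hvan : ∀ A C : Finset ι, ∑ T ∈ S.powerset, (-(u : R)) ^ invCount T (S \ T) •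
      (rowMinor u x A.sort T * rowMinor u x C.sort (S \ T)) = 0 := by
    intro A C
    rw [rowMinor, ← rowMinor, ← rowAct_eq_sum_powerset, rowMinor, ← rowAct_append]
    by_cases hn : (A.sort ++ C.sort).Nodup
    · refine rowMinor_eq_zero_of_length_ne u x _ _ (hn.length_le_card.trans_lt hS).ne
    · rw [rowAct_of_not_nodup hx hn]
      rfl
  simp only [hlap, sum_mul_sum, smul_sum]
  rw [sum_comm]
  refine sum_eq_zero fun A _ => ?_
  rw [sum_comm]
  refine sum_eq_zero fun C _ => ?_
  have h := hvan (univ \ A) C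
  apply_fun fun z => ((-(u : R)) ^ invCount A (univ \ A) * (-(u : R)) ^ invCount C (univ \ C)) •
    (rowMinor u x A.sort I₀ * z * rowMinor u x (univ \ C).sort J₀) at h
  simp only [mul_zero, zero_mul, smul_zero, mul_sum, sum_mul, smul_sum] at h
  rw [← h]
  refine sum_congr rfl fun T _ => ?_
  simp only [smul_mul_assoc, mul_smul_comm, smul_smul, mul_assoc]
  congr 1
  ring

end QuantumMinors

section NoncrossingMatchings

open Finset

/-- For finite sets of the same cardinality, the `s`-th smallest element of `L` is at most the
`s`-th smallest element of `M`, for all `s`. -/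
def DomLE (L M : Finset ℕ) : Prop :=
  ∀ k, (M.filter (· ≤ k)).card ≤ (L.filter (· ≤ k)).card

theorem DomLE.trans {L M N : Finset ℕ} (h : DomLE L M) (h' : DomLE M N) : DomLE L N :=
  fun k => (h' k).trans (h k)

theorem card_filter_le_succ (L : Finset ℕ) (k : ℕ) :
    (L.filter (· ≤ k + 1)).card = (L.filter (· ≤ k)).card + if k + 1 ∈ L then 1 else 0 := by
  have h : L.filter (· ≤ k + 1) = L.filter (· ≤ k) ∪ L.filter (· = k + 1) := by
    ext a
    simp only [mem_filter, mem_union]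
    grind
  rw [h, card_union_of_disjoint, filter_eq']
  · split_ifs <;> simp
  · rw [disjoint_filter]
    grind

theorem DomLE.antisymm {L M : Finset ℕ} (h : DomLE L M) (h' : DomLE M L) : L = M := by
  have hc : ∀ k, (L.filter (· ≤ k)).card = (M.filter (· ≤ k)).card :=
    fun k => le_antisymm (h' k) (h k)
  ext k
  cases k with
  | zero =>
    have := hc 0
    simp only [nonpos_iff_eq_zero, filter_eq'] at this
    split_ifs at this <;> simp_all
  | succ k =>
    have := hc (k + 1)
    rw [card_filter_le_succ, card_filter_le_succ, hc k] at this
    split_ifs at this <;> simp_all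

/-- A noncrossing perfect matching `π` between `P` and `N` whose arcs start in `P`. -/
structure IsNoncrossingMatching (P N : Finset ℕ) (π : ℕ → ℕ) : Prop where
  map_left : ∀ a ∈ P, π a ∈ N
  map_right : ∀ b ∈ N, π b ∈ P
  left_inv : ∀ a ∈ P, π (π a) = a
  right_inv : ∀ b ∈ N, π (π b) = b
  lt_map : ∀ a ∈ P, a < π a
  noncrossing : ∀ a ∈ P, ∀ b ∈ P ∪ N, a < b → b < π a → a < π b ∧ π b < π a

theorem exists_isNoncrossingMatching {P N : Finset ℕ} (hd : Disjoint P N)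
    (hc : P.card = N.card) (h : DomLE P N) : ∃ π, IsNoncrossingMatching P N π := by
  induction hn : N.card generalizing P N with
  | zero =>
    obtain rfl := card_eq_zero.1 hn
    obtain rfl := card_eq_zero.1 (hc.trans hn)
    exact ⟨id, by constructor <;> simp⟩
  | succ c ih =>
    have hN : N.Nonempty := card_pos.1 (by omega)
    obtain ⟨b, hb, hbmin⟩ : ∃ b ∈ N, ∀ x ∈ N, b ≤ x :=
      ⟨N.min' hN, N.min'_mem hN, fun x hx => N.min'_le x hx⟩
    have hbP : b ∉ P := disjoint_right.1 hd hb
    have hne : (P.filter (· ≤ b)).Nonempty := by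
      refine card_pos.1 (lt_of_lt_of_le (card_pos.2 ⟨b, ?_⟩) (h b))
      simp [hb]
    obtain ⟨a, ha, hamax⟩ := exists_max_image _ id hne
    simp only [mem_filter, id] at ha hamax
    have hab : a < b := lt_of_le_of_ne ha.2 fun e => hbP (e ▸ ha.1)
    have haN : a ∉ N := disjoint_left.1 hd ha.1
    obtain ⟨π, hπ⟩ := ih (P := P.erase a) (N := N.erase b)
      (hd.mono (erase_subset _ _) (erase_subset _ _))
      (by rw [card_erase_of_mem ha.1, card_erase_of_mem hb, hc]) (fun k => by
        rw [filter_erase, filter_erase]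
        by_cases hk : k < b
        · have : (N.filter (· ≤ k)) = ∅ := by
            rw [filter_eq_empty_iff]
            intro x hx
            have := hbmin x hx
            omega
          simp [this]
        · rw [card_erase_of_mem (by simp [hb]; omega), card_erase_of_mem (by simp [ha.1]; omega)]
          have := h k
          omega) (by rw [card_erase_of_mem hb, hn]; rfl)
    obtain ⟨h1, h2, h3, h4, h5, h6⟩ := hπ
    simp only [mem_erase, mem_union] at h1 h2 h3 h4 h5 h6
    refine ⟨fun k => if k = a then b else if k = b then a else π k, ?_, ?_, ?_, ?_, ?_, ?_⟩
    · grind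
    · grind
    · grind
    · grind
    · grind
    · simp only [mem_union]
      grind

theorem IsNoncrossingMatching.exists_balanced_arc {P N : Finset ℕ} {π : ℕ → ℕ}
    (hπ : IsNoncrossingMatching P N π) (ω : ℕ → ℤ) (h1 : ∀ k ∈ P ∪ N, ω k = 1 ∨ ω k = -1)
    (h0 : ∀ k ∉ P ∪ N, ω k = 0 ∨ ω k = -2) {e : ℕ} (he : P ∪ N ⊆ range e)
    (hpos : 0 < ∑ k ∈ range e, ω k) :
    ∃ a ∈ P, ω a = 1 ∧ ω (π a) = 1 ∧ ∑ k ∈ Ioo a (π a), ω k = 0 := by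
  by_contra hno
  push Not at hno
  obtain ⟨m1, m2, m3, m4, m5, m6⟩ := hπ
  have key : ∀ d s t, t - s = d → (∀ k ∈ P ∪ N, s ≤ k → k < t → s ≤ π k ∧ π k < t) →
      Even (∑ k ∈ Ico s t, ω k) ∧ ∑ k ∈ Ico s t, ω k ≤ 0 := by
    intro d
    induction d using Nat.strong_induction_on with
    | _ d ih =>
      intro s t hd hcl
      by_cases hst : s < t
      swap
      · simp [Ico_eq_empty hst]
      by_cases hs : s ∈ P ∪ N
      swap
      · have := ih (t - (s + 1)) (by omega) (s + 1) t rfl (by grind)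
        rw [sum_eq_sum_Ico_succ_bot hst]
        have := h0 s hs
        grind
      have hsP : s ∈ P := by grind
      have hlt := m5 s hsP
      have hlt' := (hcl s hs le_rfl hst).2
      by_cases hlast : π s + 1 < t
      · have e1 := ih (π s + 1 - s) (by omega) s (π s + 1) rfl (by grind)
        have e2 := ih (t - (π s + 1)) (by omega) (π s + 1) t rfl (by grind)
        rw [← sum_Ico_consecutive ω (show s ≤ π s + 1 by omega) hlast.le]
        exact ⟨e1.1.add e2.1, by omega⟩
      · obtain rfl : t = π s + 1 := by omega
        have e1 := ih (π s - (s + 1)) (by omega) (s + 1) (π s) rfl (by grind)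
        have hI : Ioo s (π s) = Ico (s + 1) (π s) := by ext; simp
        have hno := hno s hsP
        rw [hI] at hno
        rw [sum_Ico_succ_top hlt.le, sum_eq_sum_Ico_succ_bot hlt]
        have := h1 s hs
        have := h1 (π s) (by grind)
        grind
  have := (key _ 0 e rfl (by
    intro k hk _ _
    refine ⟨Nat.zero_le _, mem_range.1 (he ?_)⟩
    grind)).2
  rw [← range_eq_Ico] at this
  omega

end NoncrossingMatchings

section CapFunctionals

open Finset

variable {R : Type*} [CommRing R]

/-- The coefficient at `(p.1, p.2)` of the invariant functional given by a matching `π` of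
`L \ M` with `M \ L`. -/
def capWeight (u : Rˣ) (L M : Finset ℕ) (π : ℕ → ℕ) (p : Finset ℕ × Finset ℕ) : R :=
  if p.1 ∪ p.2 = L ∪ M ∧ p.1 ∩ p.2 = L ∩ M ∧ ∀ a ∈ L \ M, (a ∈ p.1 ↔ π a ∉ p.1) then
    ((u⁻¹ : Rˣ) : R) ^ ((L \ M) \ p.1).card else 0

/-- The coefficient of `[I₀ ∪ T][(S \ T) ∪ J₀]` in the generalized Plücker relation. -/
def pluckerCoeff (u : Rˣ) (I₀ S J₀ T : Finset ℕ) : R :=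
  if Disjoint I₀ T ∧ Disjoint (S \ T) J₀ then
    (-(u : R)) ^ (invCount T (S \ T) + invCount I₀ T + invCount (S \ T) J₀) else 0

variable (u : Rˣ) {L M : Finset ℕ} {π : ℕ → ℕ}

theorem capWeight_self (hπ : IsNoncrossingMatching (L \ M) (M \ L) π) :
    capWeight u L M π (L, M) = 1 := by
  have h : ∀ a ∈ L \ M, (a ∈ L ↔ π a ∉ L) := fun a ha => by
    have := hπ.map_left a ha
    grind
  have h' : (L \ M) \ L = ∅ := by grind
  rw [capWeight, if_pos ⟨rfl, rfl, h⟩, h']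
  simp

theorem capWeight_swap (hπ : IsNoncrossingMatching (L \ M) (M \ L) π) :
    capWeight u L M π (M, L) = ((u⁻¹ : Rˣ) : R) ^ (L \ M).card := by
  have h : ∀ a ∈ L \ M, (a ∈ M ↔ π a ∉ M) := fun a ha => by
    have := hπ.map_left a ha
    grind
  have h' : (L \ M) \ M = L \ M := by grind
  simp only [capWeight, h']
  rw [if_pos ⟨union_comm _ _, inter_comm _ _, h⟩]

theorem domLE_of_separated (hπ : IsNoncrossingMatching (L \ M) (M \ L) π) {I : Finset ℕ}
    (hI : I ⊆ L ∪ M) (hs : ∀ a ∈ L \ M, a ∈ I → π a ∉ I) : DomLE L I := by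
  obtain ⟨m1, m2, m3, m4, m5, -⟩ := hπ
  intro k
  refine card_le_card_of_injOn (fun i => if i ∈ L then i else π i) ?_ ?_
  · intro i hi
    simp only [coe_filter, Set.mem_ofPred_eq] at hi ⊢
    grind
  · intro i hi j hj hij
    simp only [coe_filter, Set.mem_ofPred_eq] at hi hj hij
    grind

variable {u}

theorem domLE_of_capWeight_ne_zero (hπ : IsNoncrossingMatching (L \ M) (M \ L) π)
    {p : Finset ℕ × Finset ℕ} (h : capWeight u L M π p ≠ 0) : DomLE L p.1 ∧ DomLE L p.2 := by
  obtain ⟨h1, h2, h3⟩ := (ite_ne_right_iff.1 h).1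
  have m1 := hπ.map_left
  constructor
  · exact domLE_of_separated hπ (h1 ▸ subset_union_left) (by grind)
  · refine domLE_of_separated hπ (h1 ▸ subset_union_right) ?_
    intro a ha
    have := m1 a ha
    have := h3 a ha
    have e1 : a ∈ p.1 ∪ p.2 := by grind
    have e2 : a ∉ p.1 ∩ p.2 := by grind
    have e3 : π a ∈ p.1 ∪ p.2 := by grind
    have e4 : π a ∉ p.1 ∩ p.2 := by grind
    grind

theorem invCount_left_of_lt (X : Finset ℕ) {a b : ℕ} (hab : a < b) (ha : a ∉ X) :
    invCount {b} X = invCount {a} X + (X.filter (fun k => a < k ∧ k < b)).card := by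
  simp only [invCount, sum_singleton, card_filter, ← sum_add_distrib]
  refine sum_congr rfl fun k hk => ?_
  have : k ≠ a := fun h => ha (h ▸ hk)
  split_ifs <;> omega

theorem invCount_right_of_lt (X : Finset ℕ) {a b : ℕ} (hab : a < b) (hb : b ∉ X) :
    invCount X {a} = invCount X {b} + (X.filter (fun k => a < k ∧ k < b)).card := by
  simp only [invCount, sum_singleton, card_filter, ← sum_add_distrib]
  refine sum_congr rfl fun k hk => ?_
  have : k ≠ b := fun h => hb (h ▸ hk)
  split_ifs <;> omega

theorem pluckerCoeff_mul_capWeight_add (hπ : IsNoncrossingMatching (L \ M) (M \ L) π)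
    {I₀ S J₀ P : Finset ℕ} {a : ℕ} (ha : a ∈ L \ M) (haS : a ∈ S) (hbS : π a ∈ S)
    (haI : a ∉ I₀) (hbI : π a ∉ I₀) (haJ : a ∉ J₀) (hbJ : π a ∉ J₀)
    (hP : P ⊆ S) (haP : a ∉ P) (hbP : π a ∉ P)
    (hbal : (S.filter (fun k => a < k ∧ k < π a)).card =
      (I₀.filter (fun k => a < k ∧ k < π a)).card +
        (J₀.filter (fun k => a < k ∧ k < π a)).card) :
    pluckerCoeff u I₀ S J₀ (insert a P) *
        capWeight u L M π (I₀ ∪ insert a P, S \ insert a P ∪ J₀) +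
      pluckerCoeff u I₀ S J₀ (insert (π a) P) *
        capWeight u L M π (I₀ ∪ insert (π a) P, S \ insert (π a) P ∪ J₀) = 0 := by
  have hb := hπ.map_left a ha
  have hab := hπ.lt_map a ha
  have hπ1 := hπ.map_left
  have hπ3 := hπ.left_inv
  set b := π a with hbdef
  set N := S \ insert a (insert b P) with hN
  have haN : a ∉ N := by grind
  have hbN : b ∉ N := by grind
  have e1 : S \ insert a P = insert b N := by grind
  have e2 : S \ insert b P = insert a N := by grind
  have hS : S.filter (fun k => a < k ∧ k < b) =
      P.filter (fun k => a < k ∧ k < b) ∪ N.filter (fun k => a < k ∧ k < b) := by grind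
  have hcard : (S.filter (fun k => a < k ∧ k < b)).card =
      (P.filter (fun k => a < k ∧ k < b)).card + (N.filter (fun k => a < k ∧ k < b)).card := by
    rw [hS, card_union_of_disjoint]
    rw [disjoint_left]
    grind
  have hexp : invCount (insert b P) (insert a N) + invCount I₀ (insert b P) +
      invCount (insert a N) J₀ = invCount (insert a P) (insert b N) + invCount I₀ (insert a P) +
      invCount (insert b N) J₀ + 1 := by
    rw [invCount_insert_left hbP, invCount_insert_right _ haN, invCount_insert_right _ haN,
      invCount_insert_right _ hbP, invCount_insert_left haN, invCount_insert_left haP,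
      invCount_insert_right _ hbN, invCount_insert_right _ hbN, invCount_insert_right _ haP,
      invCount_insert_left hbN, invCount_singleton, invCount_singleton, if_pos hab,
      if_neg hab.not_gt, invCount_left_of_lt N hab haN, invCount_left_of_lt J₀ hab haJ,
      invCount_right_of_lt P hab hbP, invCount_right_of_lt I₀ hab hbI]
    omega
  have hcoeff : pluckerCoeff u I₀ S J₀ (insert b P) =
      (-(u : R)) * pluckerCoeff u I₀ S J₀ (insert a P) := by
    simp only [pluckerCoeff, e1, e2, hexp, disjoint_insert_left, disjoint_insert_right, haI, hbI,
      haJ, hbJ, pow_succ', mul_ite, mul_zero]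
  have hcap : capWeight u L M π (I₀ ∪ insert a P, insert b N ∪ J₀) =
      (u : R) * capWeight u L M π (I₀ ∪ insert b P, insert a N ∪ J₀) := by
    have hc1 : I₀ ∪ insert a P ∪ (insert b N ∪ J₀) = I₀ ∪ insert b P ∪ (insert a N ∪ J₀) := by
      grind
    have hc2 : (I₀ ∪ insert a P) ∩ (insert b N ∪ J₀) =
        (I₀ ∪ insert b P) ∩ (insert a N ∪ J₀) := by
      grind
    have hc3 : (∀ c ∈ L \ M, (c ∈ I₀ ∪ insert a P ↔ π c ∉ I₀ ∪ insert a P)) ↔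
        ∀ c ∈ L \ M, (c ∈ I₀ ∪ insert b P ↔ π c ∉ I₀ ∪ insert b P) := by
      refine forall₂_congr fun c hc => ?_
      have := hπ1 c hc
      have := hπ3 c hc
      have := hπ3 a ha
      by_cases hca : c = a
      · subst hca
        grind
      · have : π c ≠ b := by grind
        grind
    have hc4 : (L \ M) \ (I₀ ∪ insert b P) = insert a ((L \ M) \ (I₀ ∪ insert a P)) := by grind
    have hc5 : a ∉ (L \ M) \ (I₀ ∪ insert a P) := by grind
    simp only [capWeight, hc1, hc2, hc3, hc4, card_insert_of_notMem hc5, pow_succ', mul_ite,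
      mul_zero, ← mul_assoc, Units.mul_inv, one_mul]
  rw [e1, e2, hcoeff, hcap]
  ring

theorem exchange_involutive {a b : ℕ} (hab : a ≠ b) : Function.Involutive fun T : Finset ℕ =>
    if a ∈ T ∧ b ∉ T then insert b (T.erase a) else
      if b ∈ T ∧ a ∉ T then insert a (T.erase b) else T := by
  intro T
  by_cases ha : a ∈ T <;> by_cases hb : b ∈ T <;> simp [ha, hb, hab, hab.symm]

theorem sum_pluckerCoeff_mul_capWeight (hπ : IsNoncrossingMatching (L \ M) (M \ L) π)
    (c : ℕ) {I₀ S J₀ : Finset ℕ} (hS : I₀.card + J₀.card < S.card) :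
    ∑ T ∈ powersetCard c S, pluckerCoeff u I₀ S J₀ T *
      capWeight u L M π (I₀ ∪ T, S \ T ∪ J₀) = 0 := by
  by_cases hall : ∀ T ∈ powersetCard c S, pluckerCoeff u I₀ S J₀ T *
      capWeight u L M π (I₀ ∪ T, S \ T ∪ J₀) = 0
  · exact sum_eq_zero hall
  push Not at hall
  obtain ⟨T, hT, hne⟩ := hall
  have hTS := (mem_powersetCard.1 hT).1
  obtain ⟨hd1, hd2⟩ := (ite_ne_right_iff.1 (left_ne_zero_of_mul hne)).1
  obtain ⟨hu, hi, -⟩ := (ite_ne_right_iff.1 (right_ne_zero_of_mul hne)).1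
  rw [disjoint_left] at hd1 hd2
  have hu' := fun k => Finset.ext_iff.1 hu k
  have hi' := fun k => Finset.ext_iff.1 hi k
  simp only [mem_union, mem_inter, mem_sdiff] at hu' hi' hd2
  set ω : ℕ → ℤ := fun k => (if k ∈ S then 1 else 0) - (if k ∈ I₀ then 1 else 0) -
    (if k ∈ J₀ then 1 else 0) with hω
  obtain ⟨e, he⟩ : ∃ e, S ∪ I₀ ∪ J₀ ∪ (L ∪ M) ⊆ range e :=
    ⟨_, subset_range_sup_succ _⟩
  have hsum : ∀ X ⊆ range e, ∑ k ∈ range e, (if k ∈ X then (1 : ℤ) else 0) = X.card := by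
    intro X hX
    rw [sum_boole, filter_mem_eq_inter, inter_eq_right.2 hX]
  obtain ⟨a, haP, ha1, hb1, hbal⟩ := hπ.exists_balanced_arc ω
    (fun k hk => by
      simp only [mem_union, mem_sdiff] at hk
      simp only [hω]
      have := hu' k; have := hi' k; have := @hd1 k; have := @hd2 k; have := @hTS k
      by_cases k ∈ S <;> by_cases k ∈ I₀ <;> by_cases k ∈ J₀ <;> by_cases k ∈ T <;> simp_all)
    (fun k hk => by
      simp only [mem_union, mem_sdiff] at hk
      simp only [hω]
      have := hu' k; have := hi' k; have := @hd1 k; have := @hd2 k; have := @hTS k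
      by_cases k ∈ S <;> by_cases k ∈ I₀ <;> by_cases k ∈ J₀ <;> by_cases k ∈ T <;> simp_all)
    (e := e) (by grind) (by
      simp only [hω, sum_sub_distrib]
      rw [hsum S (by grind), hsum I₀ (by grind), hsum J₀ (by grind)]
      omega)
  have hmem : ∀ k, ω k = 1 → k ∈ S ∧ k ∉ I₀ ∧ k ∉ J₀ := by
    intro k hk
    simp only [hω] at hk
    split_ifs at hk <;> simp_all
  obtain ⟨haS, haI, haJ⟩ := hmem a ha1
  obtain ⟨hbS, hbI, hbJ⟩ := hmem _ hb1
  have hab := hπ.lt_map a haP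
  have hbM := hπ.map_left a haP
  have hbal' : (S.filter (fun k => a < k ∧ k < π a)).card =
      (I₀.filter (fun k => a < k ∧ k < π a)).card +
        (J₀.filter (fun k => a < k ∧ k < π a)).card := by
    have hI : ∀ X : Finset ℕ, ∑ k ∈ Ioo a (π a), (if k ∈ X then (1 : ℤ) else 0) =
        (X.filter (fun k => a < k ∧ k < π a)).card := by
      intro X
      rw [sum_boole]
      congr 2
      ext k
      simp
      tauto
    simp only [hω, sum_sub_distrib, hI] at hbal
    omega
  have hpair := fun P hP ha hb => pluckerCoeff_mul_capWeight_add (u := u) hπ (P := P) haP haS hbS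
    haI hbI haJ hbJ hP ha hb hbal'
  have hzero : ∀ T ⊆ S, (a ∈ T ↔ π a ∈ T) → pluckerCoeff u I₀ S J₀ T *
      capWeight u L M π (I₀ ∪ T, S \ T ∪ J₀) = 0 := by
    intro T _ hT
    rw [capWeight, if_neg, mul_zero]
    rintro ⟨-, -, h⟩
    have := h a haP
    simp only [mem_union, haI, hbI, false_or] at this
    tauto
  refine sum_involution (fun T _ => if a ∈ T ∧ π a ∉ T then insert (π a) (T.erase a) else
    if π a ∈ T ∧ a ∉ T then insert a (T.erase (π a)) else T) ?_ ?_ ?_ ?_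
  · intro T hT
    have hTS := (mem_powersetCard.1 hT).1
    split_ifs with h1 h2
    · have := hpair (T.erase a) ((erase_subset _ _).trans hTS) (by simp) (by simp [h1.2])
      rwa [insert_erase h1.1] at this
    · have := hpair (T.erase (π a)) ((erase_subset _ _).trans hTS) (by simp [h2.2]) (by simp)
      rwa [insert_erase h2.1, add_comm] at this
    · rw [hzero T hTS (by tauto), add_zero]
  · intro T hT hne
    have hTS := (mem_powersetCard.1 hT).1
    split_ifs with h1 h2
    · grind
    · grind
    · exact absurd (hzero T hTS (by tauto)) hne
  · intro T hT
    rw [mem_powersetCard] at hT ⊢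
    split_ifs with h1 h2
    · refine ⟨by grind, ?_⟩
      rw [card_insert_of_notMem (by simp [h1.2]), card_erase_add_one h1.1, hT.2]
    · refine ⟨by grind, ?_⟩
      rw [card_insert_of_notMem (by simp [h2.2]), card_erase_add_one h2.1, hT.2]
    · exact hT
  · intro T hT
    exact exchange_involutive hab.ne T

end CapFunctionals

section Straightening

open Finset

variable {R : Type*} [CommRing R] (u : Rˣ)

/-- The generalized Plücker relation, as a formal combination of products of two minors. -/
noncomputable def pluckerVector (c : ℕ) (I₀ S J₀ : Finset ℕ) : Finset ℕ × Finset ℕ →₀ R :=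
  ∑ T ∈ powersetCard c S, Finsupp.single (I₀ ∪ T, S \ T ∪ J₀) (pluckerCoeff u I₀ S J₀ T)

/-- The span of the generalized Plücker relations between products of two `m × m` minors. -/
noncomputable def pluckerModule (m : ℕ) : Submodule R (Finset ℕ × Finset ℕ →₀ R) :=
  Submodule.span R {v | ∃ c I₀ S J₀, I₀.card + c = m ∧ I₀.card + J₀.card + S.card = 2 * m ∧
    m < S.card ∧ v = pluckerVector u c I₀ S J₀}

/-- The pairs `(L, M)` of `m`-element sets with `L ≤ M` and the same content as `(I, J)`. -/
def standardPairs (m : ℕ) (I J : Finset ℕ) : Set (Finset ℕ × Finset ℕ) :=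
  {p | p.1.card = m ∧ p.2.card = m ∧ p.1 ∪ p.2 = I ∪ J ∧ p.1 ∩ p.2 = I ∩ J ∧ DomLE p.1 p.2}

variable {u} {m : ℕ} {I J : Finset ℕ}

theorem linearCombination_capWeight_eq_zero {L M : Finset ℕ} {π : ℕ → ℕ}
    (hπ : IsNoncrossingMatching (L \ M) (M \ L) π) {v : Finset ℕ × Finset ℕ →₀ R}
    (hv : v ∈ pluckerModule u m) : Finsupp.linearCombination R (capWeight u L M π) v = 0 := by
  suffices h : pluckerModule u m ≤
      LinearMap.ker (Finsupp.linearCombination R (capWeight u L M π)) from h hv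
  refine Submodule.span_le.2 ?_
  rintro _ ⟨c, I₀, S, J₀, -, h, h', rfl⟩
  rw [SetLike.mem_coe, LinearMap.mem_ker, pluckerVector, map_sum]
  simp only [Finsupp.linearCombination_single, smul_eq_mul]
  exact sum_pluckerCoeff_mul_capWeight hπ c (by omega)

theorem sum_exchange_lt {k : ℕ} {X Y T : Finset ℕ} (hX : ∀ a ∈ X, k < a) (hY : ∀ a ∈ Y, a ≤ k)
    (hT : T ⊆ Y ∪ X) (hc : T.card = X.card) (hne : T ≠ X) : ∑ a ∈ T, a < ∑ a ∈ X, a := by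
  have hcard : (T \ X).card = (X \ T).card := by
    have h1 := card_sdiff_add_card_inter T X
    have h2 := card_sdiff_add_card_inter X T
    rw [inter_comm] at h2
    omega
  have hpos : 0 < (X \ T).card := by
    rw [card_pos, sdiff_nonempty]
    exact fun h => hne (eq_of_subset_of_card_le h hc.le).symm
  have h1 : ∑ a ∈ T \ X, a ≤ (T \ X).card * k := by
    rw [← smul_eq_mul]
    exact sum_le_card_nsmul _ _ _ fun a ha => hY a (by grind)
  have h2 : (X \ T).card * (k + 1) ≤ ∑ a ∈ X \ T, a := by
    rw [← smul_eq_mul]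
    exact card_nsmul_le_sum _ _ _ fun a ha => hX a (by grind)
  have h3 := sum_inter_add_sum_sdiff T X (fun a => a)
  have h4 := sum_inter_add_sum_sdiff X T (fun a => a)
  rw [inter_comm] at h4
  rw [hcard] at h1
  rw [mul_add] at h2
  omega

theorem exchange_content (k : ℕ) {T : Finset ℕ}
    (hT : T ⊆ J.filter (· ≤ k) ∪ I.filter (¬ · ≤ k)) (h : Disjoint (I.filter (· ≤ k)) T)
    (h' : Disjoint ((J.filter (· ≤ k) ∪ I.filter (¬ · ≤ k)) \ T) (J.filter (¬ · ≤ k))) :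
    I.filter (· ≤ k) ∪ T ∪ ((J.filter (· ≤ k) ∪ I.filter (¬ · ≤ k)) \ T ∪
        J.filter (¬ · ≤ k)) = I ∪ J ∧
      (I.filter (· ≤ k) ∪ T) ∩ ((J.filter (· ≤ k) ∪ I.filter (¬ · ≤ k)) \ T ∪
        J.filter (¬ · ≤ k)) = I ∩ J := by
  rw [disjoint_left] at h h'
  constructor <;> ext a <;> specialize @hT a <;> specialize @h a <;> specialize @h' a <;>
    simp only [mem_union, mem_sdiff, mem_filter, mem_inter] at * <;>
    by_cases a ≤ k <;> by_cases a ∈ T <;> by_cases a ∈ I <;> by_cases a ∈ J <;> simp_all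

theorem single_mem_pluckerModule_sup_supported (hI : I.card = m) (hJ : J.card = m) :
    Finsupp.single (I, J) (1 : R) ∈
      pluckerModule u m ⊔ Finsupp.supported R R (standardPairs m I J) := by
  induction hs : ∑ i ∈ I, i using Nat.strong_induction_on generalizing I J with
  | _ s ih =>
  subst hs
  by_cases hIJ : DomLE I J
  · exact Submodule.mem_sup_right (Finsupp.single_mem_supported R 1 ⟨hI, hJ, rfl, rfl, hIJ⟩)
  obtain ⟨k, hk⟩ := not_forall.1 hIJ
  set I₀ := I.filter (· ≤ k) with hI₀
  set I₁ := I.filter (¬ · ≤ k) with hI₁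
  set J₁ := J.filter (· ≤ k) with hJ₁
  set J₀ := J.filter (¬ · ≤ k) with hJ₀
  have cI : I₀.card + I₁.card = m := by rw [card_filter_add_card_filter_not, hI]
  have cJ : J₁.card + J₀.card = m := by rw [card_filter_add_card_filter_not, hJ]
  have hd : Disjoint J₁ I₁ := by
    rw [disjoint_left]
    grind
  have cS : (J₁ ∪ I₁).card = J₁.card + I₁.card := card_union_of_disjoint hd
  have hIsum : ∑ i ∈ I, i = ∑ i ∈ I₀, i + ∑ i ∈ I₁, i :=
    (sum_filter_add_sum_filter_not I (· ≤ k) _).symm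
  set W := pluckerModule u m ⊔ Finsupp.supported R R (standardPairs m I J) with hW
  have hv : pluckerVector u I₁.card I₀ (J₁ ∪ I₁) J₀ ∈ W :=
    Submodule.mem_sup_left (Submodule.subset_span ⟨_, _, _, _, cI, by omega, by omega, rfl⟩)
  have hI₁mem : I₁ ∈ powersetCard I₁.card (J₁ ∪ I₁) :=
    mem_powersetCard.2 ⟨subset_union_right, rfl⟩
  rw [pluckerVector, ← add_sum_erase _ _ hI₁mem] at hv
  have hrest : ∑ T ∈ (powersetCard I₁.card (J₁ ∪ I₁)).erase I₁,
      Finsupp.single (I₀ ∪ T, (J₁ ∪ I₁) \ T ∪ J₀) (pluckerCoeff u I₀ (J₁ ∪ I₁) J₀ T) ∈ W := by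
    refine Submodule.sum_mem _ fun T hT => ?_
    obtain ⟨hne, hT⟩ := mem_erase.1 hT
    obtain ⟨hTS, hTc⟩ := mem_powersetCard.1 hT
    by_cases hdis : Disjoint I₀ T ∧ Disjoint ((J₁ ∪ I₁) \ T) J₀
    swap
    · rw [pluckerCoeff, if_neg hdis, Finsupp.single_zero]
      exact W.zero_mem
    obtain ⟨d1, d2⟩ := hdis
    have hsum : ∑ i ∈ I₀ ∪ T, i < ∑ i ∈ I, i := by
      rw [sum_union d1, hIsum]
      have := sum_exchange_lt (k := k) (X := I₁) (Y := J₁) (by grind) (by grind) hTS hTc hne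
      omega
    have c1 : (I₀ ∪ T).card = m := by rw [card_union_of_disjoint d1]; omega
    have c2 : ((J₁ ∪ I₁) \ T ∪ J₀).card = m := by
      rw [card_union_of_disjoint d2, card_sdiff_of_subset hTS]
      omega
    have hmem := ih _ hsum c1 c2 rfl
    obtain ⟨e1, e2⟩ := exchange_content k hTS d1 d2
    rw [standardPairs, e1, e2] at hmem
    rw [← mul_one (pluckerCoeff u I₀ (J₁ ∪ I₁) J₀ T), ← smul_eq_mul, ← Finsupp.smul_single]
    exact W.smul_mem _ hmem
  have hlead := (Submodule.add_mem_iff_left W hrest).1 hv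
  have e1 : I₀ ∪ I₁ = I := filter_union_filter_not_eq _ _
  have e2 : (J₁ ∪ I₁) \ I₁ = J₁ := by rw [union_sdiff_right, sdiff_eq_self_of_disjoint hd]
  have e3 : J₁ ∪ J₀ = J := filter_union_filter_not_eq _ _
  rw [e2, e1, e3, pluckerCoeff, e2, if_pos ⟨disjoint_filter_filter_not _ _ _,
    disjoint_filter_filter_not _ _ _⟩, ← mul_one ((-(u : R)) ^ _), ← smul_eq_mul,
    ← Finsupp.smul_single] at hlead
  exact (Submodule.smul_mem_iff_of_isUnit W ((isUnit_neg_unit u).pow _)).1 hlead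

theorem exists_straightening (u : Rˣ) (hI : I.card = m) (hJ : J.card = m) :
    ∃ v : Finset ℕ × Finset ℕ →₀ R, Finsupp.single (I, J) 1 - v ∈ pluckerModule u m ∧
      ∀ p ∈ v.support, p ∈ standardPairs m I J := by
  obtain ⟨w, hw, v, hv, h⟩ := Submodule.mem_sup.1
    (single_mem_pluckerModule_sup_supported (R := R) (u := u) hI hJ)
  refine ⟨v, ?_, fun p hp => hv hp⟩
  rwa [← h, add_sub_cancel_right]

theorem DomLE.sdiff {L M : Finset ℕ} (h : DomLE L M) : DomLE (L \ M) (M \ L) := by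
  intro k
  have h1 := card_sdiff_add_card_inter (L.filter (· ≤ k)) (M.filter (· ≤ k))
  have h2 := card_sdiff_add_card_inter (M.filter (· ≤ k)) (L.filter (· ≤ k))
  have h3 : (L \ M).filter (· ≤ k) = L.filter (· ≤ k) \ M.filter (· ≤ k) := by grind
  have h4 : (M \ L).filter (· ≤ k) = M.filter (· ≤ k) \ L.filter (· ≤ k) := by grind
  rw [inter_comm] at h2
  rw [h3, h4]
  have := h k
  omega

theorem card_sdiff_eq_of_card_eq {L M : Finset ℕ} (h : L.card = M.card) :
    (L \ M).card = (M \ L).card := by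
  have h1 := card_sdiff_add_card_inter L M
  have h2 := card_sdiff_add_card_inter M L
  rw [inter_comm] at h2
  omega

theorem exists_matching_of_domLE {L M : Finset ℕ} (hc : L.card = M.card) (h : DomLE L M) :
    ∃ π, IsNoncrossingMatching (L \ M) (M \ L) π :=
  exists_isNoncrossingMatching disjoint_sdiff_sdiff (card_sdiff_eq_of_card_eq hc) h.sdiff

theorem eq_of_content_eq {p q : Finset ℕ × Finset ℕ} (hu : p.1 ∪ p.2 = q.1 ∪ q.2)
    (hi : p.1 ∩ p.2 = q.1 ∩ q.2) (h : p.1 = q.1) : p = q := by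
  refine Prod.ext h ?_
  ext a
  have h1 := Finset.ext_iff.1 hu a
  have h2 := Finset.ext_iff.1 hi a
  simp only [mem_union, mem_inter, h] at h1 h2
  tauto

theorem coeff_eq_capWeight_of_forall {v : Finset ℕ × Finset ℕ →₀ R} {p : Finset ℕ × Finset ℕ}
    (hv : Finsupp.single (I, J) 1 - v ∈ pluckerModule u m) {π : ℕ → ℕ}
    (hπ : IsNoncrossingMatching (p.1 \ p.2) (p.2 \ p.1) π)
    (h : ∀ q ∈ v.support, DomLE p.1 q.1 → q = p) :
    v p = capWeight u p.1 p.2 π (I, J) := by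
  have h0 := linearCombination_capWeight_eq_zero hπ hv
  rw [map_sub, Finsupp.linearCombination_single, one_smul, sub_eq_zero] at h0
  rw [h0, Finsupp.linearCombination_apply, Finsupp.sum, sum_eq_single p]
  · rw [show capWeight u p.1 p.2 π p = 1 from capWeight_self u hπ, smul_eq_mul, mul_one]
  · intro q hq hqp
    by_contra hne
    exact hqp (h q hq (domLE_of_capWeight_ne_zero hπ (right_ne_zero_of_mul hne)).1)
  · intro hp
    rw [Finsupp.notMem_support_iff.1 hp, zero_smul]

theorem domLE_of_mem_support {v : Finset ℕ × Finset ℕ →₀ R}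
    (hv : Finsupp.single (I, J) 1 - v ∈ pluckerModule u m)
    (hs : ∀ p ∈ v.support, p ∈ standardPairs m I J) {p : Finset ℕ × Finset ℕ}
    (hp : p ∈ v.support) : DomLE p.1 I ∧ DomLE p.1 J := by
  classical
  by_contra hcon
  obtain ⟨q, hq⟩ := exists_minimalFor (fun (q : Finset ℕ × Finset ℕ) (k : ℕ) =>
    (q.1.filter (· ≤ k)).card) (v.support.filter fun q => ¬ (DomLE q.1 I ∧ DomLE q.1 J))
    ⟨p, mem_filter.2 ⟨hp, hcon⟩⟩
  obtain ⟨hqs, hqv⟩ := mem_filter.1 hq.1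
  obtain ⟨c1, c2, hu, hi, hd⟩ := hs q hqs
  obtain ⟨π, hπ⟩ := exists_matching_of_domLE (c1.trans c2.symm) hd
  have hval := coeff_eq_capWeight_of_forall hv hπ (fun r hr hqr => by
    obtain ⟨-, -, hu', hi', -⟩ := hs r hr
    have hrv : ¬ (DomLE r.1 I ∧ DomLE r.1 J) := fun h => hqv ⟨hqr.trans h.1, hqr.trans h.2⟩
    have hrq : DomLE r.1 q.1 := hq.2 (mem_filter.2 ⟨hr, hrv⟩) hqr
    exact eq_of_content_eq (hu'.trans hu.symm) (hi'.trans hi.symm) (hrq.antisymm hqr))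
  have hne : capWeight u q.1 q.2 π (I, J) ≠ 0 := hval ▸ Finsupp.mem_support_iff.1 hqs
  exact hqv (domLE_of_capWeight_ne_zero hπ hne)

theorem coeff_swap {v : Finset ℕ × Finset ℕ →₀ R}
    (hv : Finsupp.single (I, J) 1 - v ∈ pluckerModule u m)
    (hs : ∀ p ∈ v.support, p ∈ standardPairs m I J) (hc : J.card = I.card) (hJI : DomLE J I) :
    v (J, I) = ((u⁻¹ : Rˣ) : R) ^ (J \ I).card := by
  obtain ⟨π, hπ⟩ := exists_matching_of_domLE hc hJI
  rw [← capWeight_swap u hπ]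
  refine coeff_eq_capWeight_of_forall hv hπ fun q hq hJq => ?_
  obtain ⟨-, -, hu, hi, -⟩ := hs q hq
  exact eq_of_content_eq (hu.trans (union_comm _ _)) (hi.trans (inter_comm _ _))
    ((domLE_of_mem_support hv hs hq).2.antisymm hJq)

variable {B : Type*} [Ring B] [Algebra R B]

/-- The span of the products `f L * f M` with `L < I`, `L < J` and `L ≤ M`. -/
def lowerSpan (R : Type*) [CommRing R] {B : Type*} [Ring B] [Algebra R B] (f : Finset ℕ → B)
    (m : ℕ) (I J : Finset ℕ) : Submodule R B :=
  Submodule.span R {x | ∃ L M : Finset ℕ, L.card = m ∧ M.card = m ∧ (DomLE L I ∧ L ≠ I) ∧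
    (DomLE L J ∧ L ≠ J) ∧ DomLE L M ∧ x = f L * f M}

theorem lowerSpan_comm (f : Finset ℕ → B) : lowerSpan R f m I J = lowerSpan R f m J I := by
  unfold lowerSpan
  congr 1
  ext x
  constructor <;> exact fun ⟨L, M, h1, h2, h3, h4, h5⟩ => ⟨L, M, h1, h2, h4, h3, h5⟩

variable {f : Finset ℕ → B}

theorem mul_mem_lowerSpan (hf : ∀ v ∈ pluckerModule u m,
      Finsupp.linearCombination R (fun p : Finset ℕ × Finset ℕ => f p.1 * f p.2) v = 0)
    (hI : I.card = m) (hJ : J.card = m) (hIJ : ¬ DomLE I J) (hJI : ¬ DomLE J I) :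
    f I * f J ∈ lowerSpan R f m I J := by
  obtain ⟨v, hv, hs⟩ := exists_straightening u hI hJ
  have h0 := hf _ hv
  rw [map_sub, Finsupp.linearCombination_single, one_smul, sub_eq_zero] at h0
  dsimp only at h0
  rw [h0, Finsupp.linearCombination_apply]
  refine Submodule.sum_mem _ fun p hp => Submodule.smul_mem _ _ (Submodule.subset_span ?_)
  obtain ⟨c1, c2, -, -, hd⟩ := hs p hp
  obtain ⟨d1, d2⟩ := domLE_of_mem_support hv hs hp
  exact ⟨p.1, p.2, c1, c2, ⟨d1, fun h => hIJ (h ▸ d2)⟩, ⟨d2, fun h => hJI (h ▸ d1)⟩, hd, rfl⟩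

theorem mul_sub_mem_lowerSpan (hf : ∀ v ∈ pluckerModule u m,
      Finsupp.linearCombination R (fun p : Finset ℕ × Finset ℕ => f p.1 * f p.2) v = 0)
    (hI : I.card = m) (hJ : J.card = m) (hJI : DomLE J I) (hne : J ≠ I) :
    f I * f J - ((u⁻¹ : Rˣ) : R) ^ (J \ I).card • (f J * f I) ∈ lowerSpan R f m I J := by
  obtain ⟨v, hv, hs⟩ := exists_straightening u hI hJ
  have h0 := hf _ hv
  rw [map_sub, Finsupp.linearCombination_single, one_smul, sub_eq_zero,
    ← Finsupp.single_add_erase (J, I) v, map_add, Finsupp.linearCombination_single,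
    coeff_swap hv hs (hJ.trans hI.symm) hJI] at h0
  dsimp only at h0
  rw [h0, add_sub_cancel_left, Finsupp.linearCombination_apply]
  refine Submodule.sum_mem _ fun p hp => Submodule.smul_mem _ _ (Submodule.subset_span ?_)
  rw [Finsupp.support_erase, mem_erase] at hp
  obtain ⟨hpne, hp⟩ := hp
  obtain ⟨c1, c2, hu, hi, hd⟩ := hs p hp
  obtain ⟨d1, d2⟩ := domLE_of_mem_support hv hs hp
  refine ⟨p.1, p.2, c1, c2, ⟨d1, fun h => hne (hJI.antisymm (h ▸ d2))⟩, ⟨d2, fun h => hpne ?_⟩,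
    hd, rfl⟩
  exact eq_of_content_eq (hu.trans (union_comm _ _)) (hi.trans (inter_comm _ _)) h

theorem exists_commutation (hf : ∀ v ∈ pluckerModule u m,
      Finsupp.linearCombination R (fun p : Finset ℕ × Finset ℕ => f p.1 * f p.2) v = 0)
    (hI : I.card = m) (hJ : J.card = m) :
    ∃ e : ℤ, f I * f J - ((u ^ e : Rˣ) : R) • (f J * f I) ∈ lowerSpan R f m I J := by
  rcases eq_or_ne J I with rfl | hne
  · exact ⟨0, by simp⟩
  by_cases hJI : DomLE J I
  · refine ⟨-((J \ I).card : ℤ), ?_⟩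
    have := mul_sub_mem_lowerSpan hf hI hJ hJI hne
    rwa [← Units.val_pow_eq_pow_val, inv_pow, ← zpow_natCast, ← zpow_neg] at this
  by_cases hIJ : DomLE I J
  · refine ⟨((I \ J).card : ℤ), ?_⟩
    have := (lowerSpan R f m J I).smul_mem (-((u ^ (I \ J).card : Rˣ) : R))
      (mul_sub_mem_lowerSpan hf hJ hI hIJ hne.symm)
    rw [lowerSpan_comm, ← Units.val_pow_eq_pow_val, inv_pow, smul_sub, smul_smul, neg_mul,
      Units.mul_inv, neg_one_smul, neg_smul, sub_neg_eq_add, neg_add_eq_sub] at this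
    rwa [zpow_natCast]
  · refine ⟨0, Submodule.sub_mem _ (mul_mem_lowerSpan hf hI hJ hIJ hJI)
      (Submodule.smul_mem _ _ ?_)⟩
    rw [lowerSpan_comm]
    exact mul_mem_lowerSpan hf hJ hI hJI hIJ

end Straightening

section MinorExpansion

open Finset

variable {R B ι κ : Type*} [CommRing R] [Ring B] [Algebra R B] [LinearOrder κ]

theorem linearCombination_rowMinor_eq_zero {m : ℕ} {u : Rˣ} {x : Fin m → ℕ → B}
    (hx : IsQuantumMatrix u x) {v : Finset ℕ × Finset ℕ →₀ R} (hv : v ∈ pluckerModule u m) :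
    Finsupp.linearCombination R (fun p : Finset ℕ × Finset ℕ =>
      rowMinor u x univ.sort p.1 * rowMinor u x univ.sort p.2) v = 0 := by
  suffices h : pluckerModule u m ≤ LinearMap.ker (Finsupp.linearCombination R
      (fun p : Finset ℕ × Finset ℕ => rowMinor u x univ.sort p.1 * rowMinor u x univ.sort p.2))
    from h hv
  refine Submodule.span_le.2 ?_
  rintro _ ⟨c, I₀, S, J₀, hc, -, hS, rfl⟩
  rw [SetLike.mem_coe, LinearMap.mem_ker, pluckerVector, map_sum]
  simp only [Finsupp.linearCombination_single]
  rw [← sum_rowMinor_mul_rowMinor_eq_zero hx I₀ S J₀ (by simpa using hS)]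
  have hterm : ∀ T, pluckerCoeff u I₀ S J₀ T •
      (rowMinor u x univ.sort (I₀ ∪ T) * rowMinor u x univ.sort (S \ T ∪ J₀)) =
      (-(u : R)) ^ invCount T (S \ T) •
      ((if Disjoint I₀ T then (-(u : R)) ^ invCount I₀ T • rowMinor u x univ.sort (I₀ ∪ T)
        else 0) *
      (if Disjoint (S \ T) J₀ then
        (-(u : R)) ^ invCount (S \ T) J₀ • rowMinor u x univ.sort (S \ T ∪ J₀) else 0)) := by
    intro T
    rw [pluckerCoeff]
    by_cases h1 : Disjoint I₀ T <;> by_cases h2 : Disjoint (S \ T) J₀ <;>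
      simp [h1, h2, pow_add, smul_smul, mul_assoc, mul_comm, mul_left_comm]
  simp only [hterm]
  refine sum_subset (fun T hT => mem_powerset.2 (mem_powersetCard.1 hT).1) fun T hT hT' => ?_
  split_ifs with h1
  · rw [rowMinor_eq_zero_of_length_ne u x _ (I₀ ∪ T), smul_zero, zero_mul, smul_zero]
    rw [length_sort, card_univ, Fintype.card_fin, card_union_of_disjoint h1]
    intro h
    exact hT' (mem_powersetCard.2 ⟨mem_powerset.1 hT, by omega⟩)
  all_goals simp

theorem rowMinor_eq_zero_of_mem (u : Rˣ) (x : ι → κ → B) {a : κ} (ha : ∀ i, x i a = 0)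
    (A : List ι) {S : Finset κ} (hS : a ∈ S) : rowMinor u x A S = 0 := by
  induction A generalizing S with
  | nil => exact Pi.single_eq_of_ne (ne_empty_of_mem hS) _
  | cons i A ih =>
    rw [rowMinor_cons, rowOp]
    refine sum_eq_zero fun j _ => ?_
    rcases eq_or_ne a j with rfl | hj
    · rw [ha, zero_mul, smul_zero]
    · rw [ih (mem_erase.2 ⟨hj, hS⟩), mul_zero, smul_zero]

/-- The permutation sending `0` to `p` and otherwise acting as `τ`. -/
def consPerm {k : ℕ} (p : Fin (k + 1)) (τ : Equiv.Perm (Fin k)) : Equiv.Perm (Fin (k + 1)) :=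
  p.cycleRange.symm * Equiv.Perm.decomposeFin.symm (0, τ)

theorem consPerm_zero {k : ℕ} (p : Fin (k + 1)) (τ : Equiv.Perm (Fin k)) :
    consPerm p τ 0 = p := by
  simp [consPerm]

theorem consPerm_succ {k : ℕ} (p : Fin (k + 1)) (τ : Equiv.Perm (Fin k)) (i : Fin k) :
    consPerm p τ i.succ = p.succAbove (τ i) := by
  simp [consPerm]

theorem consPerm_bijective (k : ℕ) : Function.Bijective
    fun q : Fin (k + 1) × Equiv.Perm (Fin k) => consPerm q.1 q.2 := by
  rw [Fintype.bijective_iff_injective_and_card]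
  constructor
  · rintro ⟨p, τ⟩ ⟨p', τ'⟩ h
    dsimp only at h
    obtain rfl : p = p' := by rw [← consPerm_zero p τ, h, consPerm_zero]
    congr 1
    ext1 i
    apply Fin.succAbove_right_injective (p := p)
    rw [← consPerm_succ, h, consPerm_succ]
  · simp [Fintype.card_perm, Nat.factorial_succ]

theorem sum_boole_lt_fin {k : ℕ} (p : Fin (k + 1)) :
    ∑ i : Fin (k + 1), (if i < p then 1 else 0) = (p : ℕ) := by
  rw [sum_boole, Nat.cast_id, ← Fin.card_Iio p]
  congr 1
  ext i
  simp

theorem sum_boole_succAbove_lt {k : ℕ} (p : Fin (k + 1)) :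
    ∑ i : Fin k, (if p.succAbove i < p then 1 else 0) = (p : ℕ) := by
  rw [← sum_boole_lt_fin p, Fin.sum_univ_succAbove _ p]
  simp

theorem permLength_consPerm {k : ℕ} (p : Fin (k + 1)) (τ : Equiv.Perm (Fin k)) :
    permLength (consPerm p τ) = p + permLength τ := by
  have h : ∀ {t : ℕ} (σ : Equiv.Perm (Fin t)),
      permLength σ = ∑ a, ∑ b, if a < b ∧ σ b < σ a then 1 else 0 := by
    intro t σ
    rw [permLength, card_filter, ← univ_product_univ, sum_product]
  rw [h, h, Fin.sum_univ_succ]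
  simp only [Fin.sum_univ_succ, consPerm_zero, consPerm_succ, Fin.succ_pos, true_and,
    Fin.succ_lt_succ_iff, Fin.succAbove_lt_succAbove_iff, lt_irrefl, false_and, Fin.not_lt_zero,
    if_false, zero_add]
  rw [Equiv.sum_comp τ (fun i => if p.succAbove i < p then 1 else 0), sum_boole_succAbove_lt]

theorem rowMinor_ofFn (u : Rˣ) (x : ι → κ → B) {k : ℕ} (r : Fin k → ι) {J : Fin k → κ}
    (hJ : StrictMono J) : rowMinor u x (List.ofFn r) (univ.image J) =
      ∑ σ : Equiv.Perm (Fin k), (-(u : R)) ^ permLength σ •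
        (List.ofFn fun i => x (r i) (J (σ i))).prod := by
  induction k with
  | zero => simp [rowMinor, rowAct, permLength]
  | succ k ih =>
    rw [← Equiv.sum_comp (Equiv.ofBijective _ (consPerm_bijective k)), Fintype.sum_prod_type,
      List.ofFn_succ, rowMinor_cons, rowOp, sum_image hJ.injective.injOn]
    refine sum_congr rfl fun p _ => ?_
    have hinv : invCount {J p} (univ.image J) = p := by
      rw [invCount, sum_singleton, sum_image hJ.injective.injOn]
      simp only [hJ.lt_iff_lt]
      exact sum_boole_lt_fin p
    have herase : (univ.image J).erase (J p) = univ.image (J ∘ p.succAbove) := by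
      ext a
      simp only [mem_erase, mem_image, mem_univ, true_and, Function.comp]
      constructor
      · rintro ⟨hne, i, rfl⟩
        obtain ⟨j, rfl⟩ := Fin.exists_succAbove_eq (fun h => hne (congrArg J h))
        exact ⟨j, rfl⟩
      · rintro ⟨j, rfl⟩
        exact ⟨fun h => p.succAbove_ne j (hJ.injective h), _, rfl⟩
    rw [hinv, herase, ih _ (hJ.comp p.strictMono_succAbove), mul_sum, smul_sum]
    refine sum_congr rfl fun τ _ => ?_
    simp only [Equiv.ofBijective_apply, permLength_consPerm, List.ofFn_succ, List.prod_cons,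
      consPerm_zero, consPerm_succ, pow_add, mul_smul, mul_smul_comm, Function.comp]

end MinorExpansion

section Grassmannian

open Finset

variable {m n : ℕ}

/-- The set of values of an order embedding, as a set of natural numbers. -/
def columnSet (J : Fin m ↪o Fin n) : Finset ℕ := univ.image fun i => (J i : ℕ)

theorem strictMono_val_comp (J : Fin m ↪o Fin n) : StrictMono fun i => (J i : ℕ) :=
  fun _ _ h => J.strictMono h

theorem card_columnSet (J : Fin m ↪o Fin n) : (columnSet J).card = m := by
  rw [columnSet, card_image_of_injective _ (strictMono_val_comp J).injective, card_univ,
    Fintype.card_fin]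

theorem exists_columnSet_eq {L : Finset ℕ} (hc : L.card = m) (hn : ∀ a ∈ L, a < n) :
    ∃ L' : Fin m ↪o Fin n, columnSet L' = L := by
  refine ⟨(L.attachFin hn).orderEmbOfFin (by rw [card_attachFin, hc]), ?_⟩
  have h := image_orderEmbOfFin_univ (L.attachFin hn) (k := m) (by rw [card_attachFin, hc])
  ext a
  have h' := fun b => Finset.ext_iff.1 h b
  simp only [mem_image, mem_univ, true_and, mem_attachFin] at h'
  simp only [columnSet, mem_image, mem_univ, true_and]
  constructor
  · rintro ⟨i, rfl⟩
    exact (h' _).1 ⟨i, rfl⟩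
  · intro ha
    obtain ⟨i, hi⟩ := (h' ⟨a, hn a ha⟩).2 ha
    exact ⟨i, by rw [hi]⟩

theorem le_of_domLE_columnSet {L M : Fin m ↪o Fin n} (h : DomLE (columnSet L) (columnSet M)) :
    L ≤ M := by
  intro s
  by_contra! hs
  have h1 : (Iic s).card ≤ ((columnSet M).filter (· ≤ (M s : ℕ))).card := by
    refine card_le_card_of_injOn (fun i => (M i : ℕ)) ?_ (strictMono_val_comp M).injective.injOn
    intro i hi
    simp only [coe_Iic, Set.mem_Iic] at hi
    simp only [columnSet, coe_filter, Set.mem_ofPred_eq, mem_image, mem_univ, true_and]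
    exact ⟨⟨i, rfl⟩, M.monotone hi⟩
  have h2 : ((columnSet L).filter (· ≤ (M s : ℕ))).card ≤ (Iio s).card := by
    refine (card_le_card ?_).trans (card_image_le (f := fun i => (L i : ℕ)))
    intro a ha
    simp only [columnSet, mem_filter, mem_image, mem_univ, true_and] at ha
    obtain ⟨⟨i, rfl⟩, hi⟩ := ha
    refine mem_image.2 ⟨i, mem_Iio.2 (L.lt_iff_lt.1 ?_), rfl⟩
    exact lt_of_le_of_lt hi hs
  rw [Fin.card_Iic] at h1
  rw [Fin.card_Iio] at h2
  have := h (M s)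
  omega

theorem lt_of_domLE_columnSet {L M : Fin m ↪o Fin n} (h : DomLE (columnSet L) (columnSet M))
    (hne : columnSet L ≠ columnSet M) : L < M :=
  lt_of_le_of_ne (le_of_domLE_columnSet h) fun h' => hne (congrArg columnSet h')

variable (A : Type*) [CommRing A] [IsDomain A] (u : Aˣ)

/-- The generic quantum matrix, extended by zero columns. -/
noncomputable def genericMatrix (m n : ℕ) (i : Fin m) (j : ℕ) :
    QuantumMat (FractionRing A) (uFrac A u) m n :=
  if h : j < n then qX _ (uFrac A u) i ⟨j, h⟩ else 0

theorem genericMatrix_of_lt (i : Fin m) (j : Fin n) :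
    genericMatrix A u m n i j = qX _ (uFrac A u) i j := by
  simp [genericMatrix]

theorem genericMatrix_of_le (i : Fin m) {j : ℕ} (hj : n ≤ j) :
    genericMatrix A u m n i j = 0 :=
  dif_neg hj.not_gt

theorem uFrac_smul (a : Aˣ) (y : QuantumMat (FractionRing A) (uFrac A u) m n) :
    (uFrac A a : FractionRing A) • y = (a : A) • y :=
  algebraMap_smul _ _ _

theorem isQuantumMatrix_genericMatrix : IsQuantumMatrix u (genericMatrix A u m n) := by
  have cases : ∀ j : ℕ, (∃ j' : Fin n, (j' : ℕ) = j) ∨ n ≤ j := fun j =>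
    (lt_or_ge j n).imp (fun h => ⟨⟨j, h⟩, rfl⟩) id
  constructor
  · intro i j l hjl
    rcases cases l with ⟨l, rfl⟩ | hl
    · obtain ⟨j, rfl⟩ : ∃ j' : Fin n, (j' : ℕ) = j := ⟨⟨j, hjl.trans l.2⟩, rfl⟩
      have := RingQuot.mkAlgHom_rel (FractionRing A)
        (qMatrixRel.row (u := uFrac A u) (m := m) i j l hjl)
      rw [map_smul, map_mul, map_mul, uFrac_smul] at this
      simpa only [genericMatrix_of_lt, qX] using this
    · simp [genericMatrix_of_le A u i hl]
  · intro i k j hik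
    rcases cases j with ⟨j, rfl⟩ | hj
    · have := RingQuot.mkAlgHom_rel (FractionRing A)
        (qMatrixRel.col (u := uFrac A u) (n := n) i k j hik)
      rw [map_smul, map_mul, map_mul, uFrac_smul] at this
      simpa only [genericMatrix_of_lt, qX] using this
    · simp [genericMatrix_of_le A u _ hj]
  · intro i k j l hki hjl
    rcases cases l with ⟨l, rfl⟩ | hl
    · obtain ⟨j, rfl⟩ : ∃ j' : Fin n, (j' : ℕ) = j := ⟨⟨j, hjl.trans l.2⟩, rfl⟩
      have := RingQuot.mkAlgHom_rel (FractionRing A)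
        (qMatrixRel.antidiag (u := uFrac A u) i k j l hki hjl)
      rw [map_mul, map_mul] at this
      simpa only [genericMatrix_of_lt, qX] using this
    · simp [genericMatrix_of_le A u _ hl]
  · intro i k j l hik hjl
    rcases cases l with ⟨l, rfl⟩ | hl
    · obtain ⟨j, rfl⟩ : ∃ j' : Fin n, (j' : ℕ) = j := ⟨⟨j, hjl.trans l.2⟩, rfl⟩
      have := RingQuot.mkAlgHom_rel (FractionRing A)
        (qMatrixRel.diag (u := uFrac A u) i k j l hik hjl)
      have hsub : (uFrac A u : FractionRing A) - ((uFrac A u)⁻¹ : (FractionRing A)ˣ) =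
          algebraMap A (FractionRing A) (u - (u⁻¹ : Aˣ)) := by
        rw [map_sub, uFrac, ← map_inv]
        rfl
      rw [map_add, map_smul, map_mul, map_mul, map_mul, hsub, algebraMap_smul] at this
      simpa only [genericMatrix_of_lt, qX] using this
    · simp [genericMatrix_of_le A u _ hl]

theorem qMaximalMinor_eq_rowMinor (J : Fin m ↪o Fin n) :
    qMaximalMinor _ (uFrac A u) J =
      rowMinor u (genericMatrix A u m n) univ.sort (columnSet J) := by
  have hsort : (univ : Finset (Fin m)).sort = List.ofFn id := by
    rw [List.ofFn_id, Fin.sort_univ]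
  rw [hsort, columnSet, rowMinor_ofFn _ _ _ (strictMono_val_comp J), qMaximalMinor]
  refine sum_congr rfl fun σ _ => ?_
  have hpow : (-(uFrac A u : FractionRing A)) ^ permLength σ =
      algebraMap A (FractionRing A) ((-(u : A)) ^ permLength σ) := by
    rw [map_pow, map_neg]
    rfl
  rw [hpow, algebraMap_smul]
  simp only [genericMatrix_of_lt, id]

theorem lowerSpan_le_span (I J : Fin m ↪o Fin n) :
    lowerSpan A (rowMinor u (genericMatrix A u m n) univ.sort) m (columnSet I) (columnSet J) ≤
      Submodule.span A {x : QuantumMat (FractionRing A) (uFrac A u) m n |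
        ∃ L M : Fin m ↪o Fin n, L < I ∧ L < J ∧ L ≤ M ∧
          x = qMaximalMinor _ (uFrac A u) L * qMaximalMinor _ (uFrac A u) M} := by
  have hzero : ∀ L : Finset ℕ, (¬ ∀ a ∈ L, a < n) →
      rowMinor u (genericMatrix A u m n) univ.sort L = 0 := by
    intro L hL
    push Not at hL
    obtain ⟨a, ha, han⟩ := hL
    exact rowMinor_eq_zero_of_mem u _ (fun i => genericMatrix_of_le A u i han) _ ha
  refine Submodule.span_le.2 ?_
  rintro _ ⟨L, M, hL, hM, ⟨hLI, hneI⟩, ⟨hLJ, hneJ⟩, hLM, rfl⟩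
  by_cases hLn : ∀ a ∈ L, a < n
  swap
  · rw [hzero L hLn, zero_mul]
    exact Submodule.zero_mem _
  by_cases hMn : ∀ a ∈ M, a < n
  swap
  · rw [hzero M hMn, mul_zero]
    exact Submodule.zero_mem _
  obtain ⟨L, rfl⟩ := exists_columnSet_eq hL hLn
  obtain ⟨M, rfl⟩ := exists_columnSet_eq hM hMn
  refine Submodule.subset_span ⟨L, M, lt_of_domLE_columnSet hLI hneI,
    lt_of_domLE_columnSet hLJ hneJ, le_of_domLE_columnSet hLM, ?_⟩
  rw [qMaximalMinor_eq_rowMinor, qMaximalMinor_eq_rowMinor]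

end Grassmannian

/-- Let `A` be a commutative integral domain, `u` a unit of `A`, and
`m ≤ n` positive integers.  For any `I, J ∈ Π_{m,n}` there is `f_{I,J} ∈ ℤ` such that in
`O_u(G_{m,n}(A))` (inside `O_u(M_{m,n}(Frac A))`) the element `[I][J] − u^{f_{I,J}}[J][I]`
is an `A`-linear combination of products `[L][M]` with `L <st I`, `L <st J` and `L ≤st M`. -/
theorem quantumGrassmannian_commutation (A : Type*) [CommRing A] [IsDomain A]
    (u : Aˣ) (m n : ℕ) (hm : 0 < m) (hmn : m ≤ n) (I J : Fin m ↪o Fin n) :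
    ∃ f : ℤ,
      qMaximalMinor _ (uFrac A u) I * qMaximalMinor _ (uFrac A u) J -
          ((u ^ f : Aˣ) : A) • (qMaximalMinor _ (uFrac A u) J * qMaximalMinor _ (uFrac A u) I)
        ∈ Submodule.span A
          {x : QuantumMat (FractionRing A) (uFrac A u) m n |
            ∃ L M : Fin m ↪o Fin n, L < I ∧ L < J ∧ L ≤ M ∧
              x = qMaximalMinor _ (uFrac A u) L * qMaximalMinor _ (uFrac A u) M} := by
  obtain ⟨f, hf⟩ := exists_commutation
    (fun v hv => linearCombination_rowMinor_eq_zero (isQuantumMatrix_genericMatrix A u) hv)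
    (card_columnSet I) (card_columnSet J)
  refine ⟨f, ?_⟩
  rw [qMaximalMinor_eq_rowMinor, qMaximalMinor_eq_rowMinor]
  exact lowerSpan_le_span A u I J hf
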